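/- arXiv:1502.05775 — 2 statements merged into one kernel-verified Lean document; each statement's English description precedes it below -/
import Mathlib

section
/- Additivity of conditional Wyner common information on independent pairs: if (X₁,Y₁,Z₁) is independent of (X₂,Y₂,Z₂), then C_W(X₁X₂; Y₁Y₂ | Z₁Z₂) = C_W(X₁;Y₁|Z₁) + C_W(X₂;Y₂|Z₂). -/
open Finset

/-- A probability mass function on a finite sample space. -/
def IsPMF {Ω : Type*} [Fintype Ω] (p : Ω → ℝ) : Prop :=
  (∀ ω, 0 ≤ p ω) ∧ ∑ ω, p ω = 1

/-- Probability that the random variable `X` takes the value `x`. -/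
noncomputable def pr {Ω 𝒳 : Type*} [Fintype Ω] [DecidableEq 𝒳]
    (p : Ω → ℝ) (X : Ω → 𝒳) (x : 𝒳) : ℝ :=
  ∑ ω, if X ω = x then p ω else 0

/-- Shannon entropy (in bits) of the random variable `X` under `p`. -/
noncomputable def H {Ω 𝒳 : Type*} [Fintype Ω] [Fintype 𝒳] [DecidableEq 𝒳]
    (p : Ω → ℝ) (X : Ω → 𝒳) : ℝ :=
  -∑ x, pr p X x * Real.logb 2 (pr p X x)

/-- Conditional entropy `H(X|Y)`. -/
noncomputable def condH {Ω 𝒳 𝒴 : Type*} [Fintype Ω] [Fintype 𝒳] [DecidableEq 𝒳]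
    [Fintype 𝒴] [DecidableEq 𝒴] (p : Ω → ℝ) (X : Ω → 𝒳) (Y : Ω → 𝒴) : ℝ :=
  H p (fun ω => (X ω, Y ω)) - H p Y

/-- Mutual information `I(X;Y)`. -/
noncomputable def MI {Ω 𝒳 𝒴 : Type*} [Fintype Ω] [Fintype 𝒳] [DecidableEq 𝒳]
    [Fintype 𝒴] [DecidableEq 𝒴] (p : Ω → ℝ) (X : Ω → 𝒳) (Y : Ω → 𝒴) : ℝ :=
  H p X + H p Y - H p (fun ω => (X ω, Y ω))

/-- Conditional mutual information `I(X;Y|Z)`. -/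
noncomputable def condMI {Ω 𝒳 𝒴 𝒵 : Type*} [Fintype Ω] [Fintype 𝒳] [DecidableEq 𝒳]
    [Fintype 𝒴] [DecidableEq 𝒴] [Fintype 𝒵] [DecidableEq 𝒵]
    (p : Ω → ℝ) (X : Ω → 𝒳) (Y : Ω → 𝒴) (Z : Ω → 𝒵) : ℝ :=
  condH p X Z - condH p X (fun ω => (Y ω, Z ω))

/-- Conditional Wyner common information C_W(X;Y|Z) of a joint pmf on 𝒳 × 𝒴 × 𝒵:
the infimum of I(XY;Q|Z) over all extensions of p by a random variable Q with
X-QZ-Y a Markov chain (by the cardinality bound |𝒬| ≤ |𝒳||𝒴|, the auxiliary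
alphabet 𝒳 × 𝒴 suffices). -/
noncomputable def CW {𝒳 𝒴 𝒵 : Type*} [Fintype 𝒳] [DecidableEq 𝒳]
    [Fintype 𝒴] [DecidableEq 𝒴] [Fintype 𝒵] [DecidableEq 𝒵]
    (p : 𝒳 × 𝒴 × 𝒵 → ℝ) : ℝ :=
  sInf {r | ∃ q : (𝒳 × 𝒴 × 𝒵) × (𝒳 × 𝒴) → ℝ,
    IsPMF q ∧ (∀ w, ∑ u, q (w, u) = p w) ∧
    condMI q (fun ω => ω.1.1) (fun ω => ω.1.2.1) (fun ω => (ω.2, ω.1.2.2)) = 0 ∧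
    r = condMI q (fun ω => (ω.1.1, ω.1.2.1)) (fun ω => ω.2) (fun ω => ω.1.2.2)}

set_option linter.unusedSectionVars false

namespace CWAux

/-- The entropy kernel. -/
noncomputable def et (x : ℝ) : ℝ := -(x * Real.logb 2 x)

lemma et_zero : et 0 = 0 := by simp [et]

lemma et_mul (c x : ℝ) : et (c * x) = c * et x + x * et c := by
  unfold et
  by_cases hc : c = 0
  · simp [hc]
  by_cases hx : x = 0
  · simp [hx]
  rw [Real.logb_mul hc hx]; ring

section basic
variable {Ω α β γ δ : Type*} [Fintype Ω] [Fintype α] [DecidableEq α] [Fintype β] [DecidableEq β]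
  [Fintype γ] [DecidableEq γ] [Fintype δ] [DecidableEq δ]

lemma H_et (P : Ω → ℝ) (X : Ω → α) : H P X = ∑ x, et (pr P X x) := by
  simp [H, et, Finset.sum_neg_distrib]

lemma pr_nonneg {P : Ω → ℝ} (hP : ∀ ω, 0 ≤ P ω) (X : Ω → α) (x : α) : 0 ≤ pr P X x := by
  unfold pr
  exact Finset.sum_nonneg fun ω _ => by split_ifs <;> simp [hP]

lemma pr_sum_fst (P : Ω → ℝ) (X : Ω → α) (Y : Ω → β) (y : β) :
    ∑ x, pr P (fun ω => (X ω, Y ω)) (x, y) = pr P Y y := by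
  unfold pr
  rw [Finset.sum_comm]
  refine Finset.sum_congr rfl fun ω _ => ?_
  by_cases h : Y ω = y <;> simp [h]

lemma pr_sum_snd (P : Ω → ℝ) (X : Ω → α) (Y : Ω → β) (x : α) :
    ∑ y, pr P (fun ω => (X ω, Y ω)) (x, y) = pr P X x := by
  unfold pr
  rw [Finset.sum_comm]
  refine Finset.sum_congr rfl fun ω _ => ?_
  by_cases h : X ω = x <;> simp [h]

lemma pr_inj (P : Ω → ℝ) (X : Ω → α) (f : α → β) (hf : Function.Injective f) (x : α) :
    pr P (fun ω => f (X ω)) (f x) = pr P X x := by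
  unfold pr
  refine Finset.sum_congr rfl fun ω _ => ?_
  simp [hf.eq_iff]

lemma H_inj (P : Ω → ℝ) (X : Ω → α) (f : α → β) (hf : Function.Injective f) :
    H P X = H P (fun ω => f (X ω)) := by
  rw [H_et, H_et]
  refine Fintype.sum_of_injective f hf _ _ (fun i hi => ?_) (fun i => ?_)
  · have : pr P (fun ω => f (X ω)) i = 0 := by
      unfold pr
      refine Finset.sum_eq_zero fun ω _ => ?_
      rw [if_neg]
      intro h
      exact hi ⟨_, h⟩
    rw [this, et_zero]
  · rw [pr_inj P X f hf]

lemma H_eq (P : Ω → ℝ) (X : Ω → α) (Y : Ω → β) (f : α → β) (g : β → α)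
    (hY : ∀ ω, Y ω = f (X ω)) (hX : ∀ ω, X ω = g (Y ω)) : H P X = H P Y := by
  have h1 := H_inj P X (fun x => (x, f x)) (fun a b h => congrArg Prod.fst h)
  have h2 := H_inj P Y (fun y => (g y, y)) (fun a b h => congrArg Prod.snd h)
  rw [h1, h2]
  congr 1
  funext ω
  simp only [← hY, ← hX]

lemma pr_push (P : Ω → ℝ) (T : Ω → α) (X : α → β) (x : β) :
    pr (fun w => pr P T w) X x = pr P (fun ω => X (T ω)) x := by
  unfold pr
  have : ∀ a, (if X a = x then ∑ ω, (if T ω = a then P ω else 0) else 0)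
      = ∑ ω, if T ω = a then (if X a = x then P ω else 0) else 0 := by
    intro a
    by_cases h : X a = x <;> simp [h]
  simp_rw [this]
  rw [Finset.sum_comm]
  refine Finset.sum_congr rfl fun ω _ => ?_
  simp

lemma H_push (P : Ω → ℝ) (T : Ω → α) (X : α → β) (p : α → ℝ) (hp : ∀ a, pr P T a = p a) :
    H P (fun ω => X (T ω)) = H p X := by
  have : p = fun w => pr P T w := funext fun a => (hp a).symm
  rw [this, H_et, H_et]
  simp_rw [pr_push]

lemma isPMF_push {P : Ω → ℝ} (hP : IsPMF P) (T : Ω → α) : IsPMF (fun w => pr P T w) := by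
  refine ⟨fun w => pr_nonneg hP.1 _ _, ?_⟩
  rw [← hP.2]
  unfold pr
  rw [Finset.sum_comm]
  simp

lemma sum_pr {P : Ω → ℝ} (hP : IsPMF P) (T : Ω → α) : ∑ w, pr P T w = 1 := (isPMF_push hP T).2

lemma pr_prod (p₁ : α → ℝ) (p₂ : β → ℝ) (A : α → γ) (B : β → δ) (c : γ) (d : δ) :
    pr (fun w : α × β => p₁ w.1 * p₂ w.2) (fun w => (A w.1, B w.2)) (c, d)
      = pr p₁ A c * pr p₂ B d := by
  unfold pr
  rw [Finset.sum_mul_sum, Fintype.sum_prod_type]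
  refine Finset.sum_congr rfl fun a _ => Finset.sum_congr rfl fun b _ => ?_
  by_cases h : A a = c <;> by_cases h' : B b = d <;> simp [h, h']

lemma H_prod (P : Ω → ℝ) (W₁ : Ω → α) (W₂ : Ω → β) (p₁ : α → ℝ) (p₂ : β → ℝ)
    (hp₁ : IsPMF p₁) (hp₂ : IsPMF p₂)
    (hW : ∀ a b, pr P (fun ω => (W₁ ω, W₂ ω)) (a, b) = p₁ a * p₂ b) (A : α → γ) (B : β → δ) :
    H P (fun ω => (A (W₁ ω), B (W₂ ω))) = H p₁ A + H p₂ B := by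
  have h := H_push P (fun ω => (W₁ ω, W₂ ω)) (fun w : α × β => (A w.1, B w.2))
    (fun w => p₁ w.1 * p₂ w.2) (fun w => hW w.1 w.2)
  simp only at h
  rw [h, H_et, H_et, H_et, Fintype.sum_prod_type]
  simp_rw [pr_prod, et_mul, Finset.sum_add_distrib, ← Finset.mul_sum, ← Finset.sum_mul]
  rw [sum_pr hp₁, sum_pr hp₂]
  ring

/-- block of conditional mutual information -/
noncomputable def G (m : α × β → ℝ) : ℝ :=
  (∑ x, et (∑ y, m (x, y))) + (∑ y, et (∑ x, m (x, y))) - et (∑ x, ∑ y, m (x, y))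
    - ∑ x, ∑ y, et (m (x, y))

/-- block of conditional entropy -/
noncomputable def F (m : α → ℝ) : ℝ := (∑ x, et (m x)) - et (∑ x, m x)

lemma F_smul (c : ℝ) (m : α → ℝ) : F (fun a => c * m a) = c * F m := by
  unfold F
  simp_rw [← Finset.mul_sum, et_mul, Finset.sum_add_distrib, ← Finset.mul_sum, ← Finset.sum_mul]
  ring

lemma G_smul (c : ℝ) (m : α × β → ℝ) : G (fun a => c * m a) = c * G m := by
  unfold G
  simp_rw [← Finset.mul_sum, et_mul, Finset.sum_add_distrib, ← Finset.mul_sum, ← Finset.sum_mul]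
  rw [Finset.sum_comm (f := fun y x => m (x, y))]
  ring

lemma G_nonneg (m : α × β → ℝ) (hm : ∀ a, 0 ≤ m a) : 0 ≤ G m := by
  set r : α → ℝ := fun x => ∑ y, m (x, y) with hr
  set c : β → ℝ := fun y => ∑ x, m (x, y) with hc
  set S : ℝ := ∑ x, ∑ y, m (x, y) with hS
  have hrS : ∑ x, r x = S := rfl
  have hcS : ∑ y, c y = S := by rw [hS, Finset.sum_comm]
  have hr0 : ∀ x, 0 ≤ r x := fun x => Finset.sum_nonneg fun y _ => hm _
  have hc0 : ∀ x, 0 ≤ c x := fun x => Finset.sum_nonneg fun y _ => hm _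
  have hS0 : 0 ≤ S := Finset.sum_nonneg fun x _ => hr0 x
  have hlog2 : 0 < Real.log 2 := Real.log_pos (by norm_num)
  have hG : G m = ∑ x, ∑ y, m (x, y) * ((Real.log (m (x, y)) + Real.log S
      - Real.log (r x) - Real.log (c y)) / Real.log 2) := by
    have e1 : ∑ x, et (r x) = ∑ x, ∑ y, m (x, y) * (-Real.log (r x) / Real.log 2) := by
      refine Finset.sum_congr rfl fun x _ => ?_
      rw [← Finset.sum_mul, et, Real.logb]; ring
    have e2 : ∑ y, et (c y) = ∑ x, ∑ y, m (x, y) * (-Real.log (c y) / Real.log 2) := by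
      rw [Finset.sum_comm]
      refine Finset.sum_congr rfl fun x _ => ?_
      rw [← Finset.sum_mul, et, Real.logb]; ring
    have e3 : et S = ∑ x, ∑ y, m (x, y) * (-Real.log S / Real.log 2) := by
      simp_rw [← Finset.sum_mul]
      rw [et, Real.logb]; ring
    have : G m = (∑ x, et (r x)) + (∑ y, et (c y)) - et S - ∑ x, ∑ y, et (m (x, y)) := rfl
    rw [this, e1, e2, e3]
    simp_rw [← Finset.sum_add_distrib, ← Finset.sum_sub_distrib]
    refine Finset.sum_congr rfl fun x _ => Finset.sum_congr rfl fun y _ => ?_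
    rw [et, Real.logb]; ring
  have key : ∀ x y, (m (x, y) - r x * c y / S) / Real.log 2 ≤
      m (x, y) * ((Real.log (m (x, y)) + Real.log S
      - Real.log (r x) - Real.log (c y)) / Real.log 2) := by
    intro x y
    rw [← mul_div_assoc]
    refine div_le_div_of_nonneg_right ?_ hlog2.le
    rcases (hm (x, y)).eq_or_lt with h | h
    · rw [← h]
      have : 0 ≤ r x * c y / S := by have := hr0 x; have := hc0 y; positivity
      simpa using this
    · have h1 : m (x, y) ≤ r x :=
        Finset.single_le_sum (f := fun y => m (x, y)) (fun i _ => hm _) (Finset.mem_univ y)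
      have h2 : m (x, y) ≤ c y :=
        Finset.single_le_sum (f := fun x => m (x, y)) (fun i _ => hm _) (Finset.mem_univ x)
      have h3 : r x ≤ S := Finset.single_le_sum (f := r) (fun i _ => hr0 _) (Finset.mem_univ x)
      have hrp : 0 < r x := by linarith
      have hcp : 0 < c y := by linarith
      have hSp : 0 < S := by linarith
      have hl := Real.log_le_sub_one_of_pos (x := r x * c y / (S * m (x, y))) (by positivity)
      rw [Real.log_div (by positivity) (by positivity), Real.log_mul hrp.ne' hcp.ne',
        Real.log_mul hSp.ne' h.ne'] at hl
      have h4 : m (x, y) * (r x * c y / (S * m (x, y))) = r x * c y / S := by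
        field_simp
      nlinarith [mul_le_mul_of_nonneg_left hl h.le]
  rw [hG]
  refine le_trans ?_ (Finset.sum_le_sum fun x _ => Finset.sum_le_sum fun y _ => key x y)
  simp_rw [← Finset.sum_div, Finset.sum_sub_distrib, ← Finset.sum_div, ← Finset.mul_sum,
    ← Finset.sum_mul]
  rw [hcS, hrS]
  refine div_nonneg ?_ hlog2.le
  have : S * S / S = S := by
    by_cases h : S = 0
    · simp [h]
    · field_simp
  rw [this]
  exact (sub_self S).ge

lemma condH_block (P : Ω → ℝ) (X : Ω → α) (S : Ω → γ) :
    condH P X S = ∑ s, F (fun x => pr P (fun ω => (X ω, S ω)) (x, s)) := by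
  unfold condH F
  rw [H_et, H_et, Fintype.sum_prod_type, Finset.sum_comm, Finset.sum_sub_distrib]
  simp_rw [pr_sum_fst]

lemma condMI_block (P : Ω → ℝ) (X : Ω → α) (Y : Ω → β) (S : Ω → γ) :
    condMI P X Y S = ∑ s, G (fun a : α × β => pr P (fun ω => ((X ω, Y ω), S ω)) (a, s)) := by
  have e : H P (fun ω => (X ω, (Y ω, S ω))) = H P (fun ω => ((X ω, Y ω), S ω)) :=
    H_eq _ _ _ (fun a => ((a.1, a.2.1), a.2.2)) (fun a => (a.1.1, a.1.2, a.2))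
      (fun _ => rfl) (fun _ => rfl)
  have h1 : ∀ x s, ∑ y, pr P (fun ω => ((X ω, Y ω), S ω)) ((x, y), s)
      = pr P (fun ω => (X ω, S ω)) (x, s) := by
    intro x s
    unfold pr
    rw [Finset.sum_comm]
    refine Finset.sum_congr rfl fun ω _ => ?_
    by_cases h : X ω = x <;> by_cases h' : S ω = s <;> simp [h, h']
  have h2 : ∀ y s, ∑ x, pr P (fun ω => ((X ω, Y ω), S ω)) ((x, y), s)
      = pr P (fun ω => (Y ω, S ω)) (y, s) := by
    intro x s
    unfold pr
    rw [Finset.sum_comm]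
    refine Finset.sum_congr rfl fun ω _ => ?_
    by_cases h : Y ω = x <;> by_cases h' : S ω = s <;> simp [h, h']
  unfold condMI condH G
  rw [e]
  simp_rw [h1, h2, pr_sum_fst]
  simp only [H_et]
  simp only [Finset.sum_sub_distrib, Finset.sum_add_distrib, Fintype.sum_prod_type]
  rw [Finset.sum_comm (s := (Finset.univ : Finset γ)) (t := (Finset.univ : Finset α))
      (f := fun s x => et (pr P (fun ω => (X ω, S ω)) (x, s))),
    Finset.sum_comm (s := (Finset.univ : Finset γ)) (t := (Finset.univ : Finset β))
      (f := fun s y => et (pr P (fun ω => (Y ω, S ω)) (y, s)))]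
  have h3 : ∑ s, ∑ x, ∑ y, et (pr P (fun ω => ((X ω, Y ω), S ω)) ((x, y), s))
    = ∑ x, ∑ y, ∑ s, et (pr P (fun ω => ((X ω, Y ω), S ω)) ((x, y), s)) := by
    rw [Finset.sum_comm]
    refine Finset.sum_congr rfl fun x _ => ?_
    rw [Finset.sum_comm]
  rw [h3]; ring

lemma condMI_nonneg {P : Ω → ℝ} (hP : ∀ ω, 0 ≤ P ω) (X : Ω → α) (Y : Ω → β) (S : Ω → γ) :
    0 ≤ condMI P X Y S := by
  rw [condMI_block]
  exact Finset.sum_nonneg fun s _ => G_nonneg _ fun a => pr_nonneg hP _ _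

lemma condMI_symm (P : Ω → ℝ) (X : Ω → α) (Y : Ω → β) (S : Ω → γ) :
    condMI P X Y S = condMI P Y X S := by
  have e : H P (fun ω => (X ω, (Y ω, S ω))) = H P (fun ω => (Y ω, (X ω, S ω))) :=
    H_eq _ _ _ (fun a => (a.2.1, a.1, a.2.2)) (fun a => (a.2.1, a.1, a.2.2))
      (fun _ => rfl) (fun _ => rfl)
  unfold condMI condH
  rw [e]; ring

lemma condMI_dp {P : Ω → ℝ} (hP : ∀ ω, 0 ≤ P ω) (X : Ω → α) (Y : Ω → β) (S : Ω → γ)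
    (f : α → δ) : condMI P (fun ω => f (X ω)) Y S ≤ condMI P X Y S := by
  have h := condMI_nonneg hP X Y (fun ω => (f (X ω), S ω))
  unfold condMI condH at *
  have e1 : H P (fun ω => (X ω, (f (X ω), S ω))) = H P (fun ω => (X ω, S ω)) :=
    H_eq _ _ _ (fun a => (a.1, a.2.2)) (fun a => (a.1, f a.1, a.2)) (fun _ => rfl) (fun _ => rfl)
  have e2 : H P (fun ω => (X ω, (Y ω, (f (X ω), S ω)))) = H P (fun ω => (X ω, (Y ω, S ω))) :=
    H_eq _ _ _ (fun a => (a.1, a.2.1, a.2.2.2)) (fun a => (a.1, a.2.1, f a.1, a.2.2))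
      (fun _ => rfl) (fun _ => rfl)
  have e3 : H P (fun ω => (Y ω, (f (X ω), S ω))) = H P (fun ω => (f (X ω), (Y ω, S ω))) :=
    H_eq _ _ _ (fun a => (a.2.1, a.1, a.2.2)) (fun a => (a.2.1, a.1, a.2.2))
      (fun _ => rfl) (fun _ => rfl)
  rw [e1, e2, e3] at h
  linarith

lemma condMI_congr {α' γ' : Type*} [Fintype α'] [DecidableEq α'] [Fintype γ'] [DecidableEq γ']
    (P : Ω → ℝ) (A : Ω → α) (A' : Ω → α') (B : Ω → β) (S : Ω → γ) (S' : Ω → γ')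
    (f : α → α') (f' : α' → α) (g : γ → γ') (g' : γ' → γ)
    (h1 : ∀ ω, A' ω = f (A ω)) (h2 : ∀ ω, A ω = f' (A' ω))
    (h3 : ∀ ω, S' ω = g (S ω)) (h4 : ∀ ω, S ω = g' (S' ω)) :
    condMI P A B S = condMI P A' B S' := by
  unfold condMI condH
  rw [H_eq P (fun ω => (A ω, S ω)) (fun ω => (A' ω, S' ω)) (fun a => (f a.1, g a.2))
      (fun a => (f' a.1, g' a.2)) (fun ω => by simp only [← h1, ← h3])
      (fun ω => by simp only [← h2, ← h4]),
    H_eq P S S' g g' h3 h4,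
    H_eq P (fun ω => (A ω, B ω, S ω)) (fun ω => (A' ω, B ω, S' ω))
      (fun a => (f a.1, a.2.1, g a.2.2))
      (fun a => (f' a.1, a.2.1, g' a.2.2)) (fun ω => by simp only [← h1, ← h3])
      (fun ω => by simp only [← h2, ← h4]),
    H_eq P (fun ω => (B ω, S ω)) (fun ω => (B ω, S' ω)) (fun a => (a.1, g a.2))
      (fun a => (a.1, g' a.2)) (fun ω => by simp only [← h3])
      (fun ω => by simp only [← h4])]

end basic

section prods
variable {Ω₁ Ω₂ α α' β β' γ γ' : Type*} [Fintype Ω₁] [Fintype Ω₂]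
  [Fintype α] [DecidableEq α] [Fintype β] [DecidableEq β]
  [Fintype γ] [DecidableEq γ] [Fintype α'] [DecidableEq α'] [Fintype β'] [DecidableEq β']
  [Fintype γ'] [DecidableEq γ']

lemma isPMF_prod {q₁ : Ω₁ → ℝ} {q₂ : Ω₂ → ℝ} (h₁ : IsPMF q₁) (h₂ : IsPMF q₂) :
    IsPMF (fun w : Ω₁ × Ω₂ => q₁ w.1 * q₂ w.2) := by
  refine ⟨fun v => mul_nonneg (h₁.1 _) (h₂.1 _), ?_⟩
  rw [Fintype.sum_prod_type, ← Finset.sum_mul_sum, h₁.2, h₂.2, one_mul]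

lemma H_prod0 {q₁ : Ω₁ → ℝ} {q₂ : Ω₂ → ℝ} (h₁ : IsPMF q₁) (h₂ : IsPMF q₂)
    (A : Ω₁ → α) (A' : Ω₂ → α') :
    H (fun w : Ω₁ × Ω₂ => q₁ w.1 * q₂ w.2) (fun w => (A w.1, A' w.2)) = H q₁ A + H q₂ A' := by
  classical
  refine H_prod _ (fun w : Ω₁ × Ω₂ => w.1) (fun w : Ω₁ × Ω₂ => w.2) q₁ q₂ h₁ h₂ (fun a b => ?_) A A'
  have := pr_inj (fun w : Ω₁ × Ω₂ => q₁ w.1 * q₂ w.2) (fun w => w) (fun w => (w.1, w.2))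
    Function.injective_id (a, b)
  rw [this]
  unfold pr
  simp

lemma condMI_prod {q₁ : Ω₁ → ℝ} {q₂ : Ω₂ → ℝ} (h₁ : IsPMF q₁) (h₂ : IsPMF q₂)
    (A : Ω₁ → α) (A' : Ω₂ → α') (B : Ω₁ → β) (B' : Ω₂ → β') (S : Ω₁ → γ) (S' : Ω₂ → γ') :
    condMI (fun w : Ω₁ × Ω₂ => q₁ w.1 * q₂ w.2) (fun w => (A w.1, A' w.2))
      (fun w => (B w.1, B' w.2)) (fun w => (S w.1, S' w.2)) =
      condMI q₁ A B S + condMI q₂ A' B' S' := by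
  unfold condMI condH
  have e1 := H_prod0 h₁ h₂ (fun w => (A w, S w)) (fun w => (A' w, S' w))
  have e2 := H_prod0 h₁ h₂ (fun w => (B w, S w)) (fun w => (B' w, S' w))
  have e3 := H_prod0 h₁ h₂ (fun w => (A w, B w, S w)) (fun w => (A' w, B' w, S' w))
  rw [H_eq _ _ (fun w : Ω₁ × Ω₂ => ((A w.1, A' w.2), (S w.1, S' w.2)))
    (fun a => ((a.1.1, a.2.1), (a.1.2, a.2.2))) (fun a => ((a.1.1, a.2.1), (a.1.2, a.2.2)))
    (fun _ => rfl) (fun _ => rfl)] at e1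
  rw [H_eq _ _ (fun w : Ω₁ × Ω₂ => ((B w.1, B' w.2), (S w.1, S' w.2)))
    (fun a => ((a.1.1, a.2.1), (a.1.2, a.2.2))) (fun a => ((a.1.1, a.2.1), (a.1.2, a.2.2)))
    (fun _ => rfl) (fun _ => rfl)] at e2
  rw [H_eq _ _ (fun w : Ω₁ × Ω₂ => ((A w.1, A' w.2), (B w.1, B' w.2), (S w.1, S' w.2)))
    (fun a => ((a.1.1, a.2.1), (a.1.2.1, a.2.2.1), (a.1.2.2, a.2.2.2)))
    (fun a => ((a.1.1, a.2.1.1, a.2.2.1), (a.1.2, a.2.1.2, a.2.2.2)))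
    (fun _ => rfl) (fun _ => rfl)] at e3
  rw [e1, e2, e3, H_prod0 h₁ h₂ S S']
  ring

end prods

/-- Support reduction for a linear programme. -/
lemma lp {ι κ : Type*} [Fintype ι] [Fintype κ] (f : ι → κ → ℝ)
    (h : ι → ℝ) : ∀ (n : ℕ) (w : ι → ℝ), (∀ u, 0 ≤ w u) → (∀ u, w u ≠ 0 → 0 < ∑ k, f u k) →
      (Finset.univ.filter fun u => w u ≠ 0).card ≤ n →
    ∃ w' : ι → ℝ, (∀ u, 0 ≤ w' u) ∧ (∀ k, ∑ u, w' u * f u k = ∑ u, w u * f u k) ∧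
      ∑ u, w u * h u ≤ ∑ u, w' u * h u ∧
      (Finset.univ.filter fun u => w' u ≠ 0).card ≤ Fintype.card κ := by
  classical
  intro n
  induction n with
  | zero =>
    intro w hw _ hc
    exact ⟨w, hw, fun _ => rfl, le_rfl, hc.trans (Nat.zero_le _)⟩
  | succ n ih =>
    intro w hw hpos hc
    by_cases hle : (Finset.univ.filter fun u => w u ≠ 0).card ≤ Fintype.card κ
    · exact ⟨w, hw, fun _ => rfl, le_rfl, hle⟩
    push Not at hle
    have hdep : ∃ c : ι → ℝ, (∀ u, w u = 0 → c u = 0) ∧ (∃ u, c u ≠ 0) ∧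
        ∀ k, ∑ u, c u * f u k = 0 := by
      have hnl : ¬ LinearIndependent ℝ (fun u : {u // w u ≠ 0} => f u.1) := by
        intro hl
        have := hl.fintype_card_le_finrank
        rw [Module.finrank_fintype_fun_eq_card, Fintype.card_subtype] at this
        omega
      rw [Fintype.not_linearIndependent_iff] at hnl
      obtain ⟨g, hg, i, hi⟩ := hnl
      refine ⟨fun u => if hu : w u ≠ 0 then g ⟨u, hu⟩ else 0, ?_, ⟨i.1, ?_⟩, ?_⟩
      · intro u hu; simp [hu]
      · simpa [i.2] using hi
      · intro k
        have := congrFun hg k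
        simp only [Finset.sum_apply, Pi.smul_apply, smul_eq_mul, Pi.zero_apply] at this
        refine Eq.trans (Eq.symm ?_) this
        refine Fintype.sum_of_injective (Subtype.val) Subtype.val_injective _ _ ?_ ?_
        · intro u hu
          have : w u = 0 := by
            by_contra hne; exact hu ⟨⟨u, hne⟩, rfl⟩
          simp [this]
        · intro u
          have := u.2
          simp
          intro h0; exact absurd h0 this
    have hdep2 : ∃ c : ι → ℝ, (∀ u, w u = 0 → c u = 0) ∧ (∃ u, c u ≠ 0) ∧
        (∀ k, ∑ u, c u * f u k = 0) ∧ 0 ≤ ∑ u, c u * h u := by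
      obtain ⟨c, h1, ⟨u, h2⟩, h3⟩ := hdep
      rcases le_total 0 (∑ u, c u * h u) with h4 | h4
      · exact ⟨c, h1, ⟨u, h2⟩, h3, h4⟩
      · refine ⟨fun u => - c u, fun u hu => by simp [h1 u hu], ⟨u, by simpa using h2⟩, ?_, ?_⟩
        · intro k; simp [Finset.sum_neg_distrib, h3 k]
        · simp [Finset.sum_neg_distrib, h4]
    obtain ⟨c, h1, ⟨u₀, h2⟩, h3, h4⟩ := hdep2
    have hneg : ∃ u, c u < 0 := by
      by_contra hcon
      push Not at hcon
      have hs : ∑ u, c u * ∑ k, f u k = 0 := by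
        simp_rw [Finset.mul_sum]
        rw [Finset.sum_comm]
        exact Finset.sum_eq_zero fun k _ => h3 k
      rw [Finset.sum_eq_zero_iff_of_nonneg] at hs
      · have := hs u₀ (Finset.mem_univ _)
        have hw0 : w u₀ ≠ 0 := fun h0 => h2 (h1 _ h0)
        rcases mul_eq_zero.1 this with h5 | h5
        · exact h2 h5
        · exact (hpos _ hw0).ne' h5
      · intro u _
        by_cases hu : w u = 0
        · simp [h1 u hu]
        · exact mul_nonneg (hcon u) (hpos u hu).le
    obtain ⟨a, ha⟩ := hneg
    obtain ⟨b, hb, hmin⟩ := Finset.exists_min_image (Finset.univ.filter fun u => c u < 0)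
      (fun u => w u / (- c u)) ⟨a, by simp [ha]⟩
    simp only [Finset.mem_filter, Finset.mem_univ, true_and] at hb hmin
    set t := w b / (- c b) with ht
    have ht0 : 0 ≤ t := div_nonneg (hw b) (by linarith)
    have hbw : w b ≠ 0 := fun h0 => by have := h1 b h0; linarith
    have hb0 : w b + t * c b = 0 := by
      have hcb : - c b ≠ 0 := by linarith
      have h5 : t * (- c b) = w b := div_mul_cancel₀ _ hcb
      linarith
    have g1 : ∀ u, 0 ≤ w u + t * c u := by
      intro u
      by_cases hu : c u < 0
      · have := hmin u hu
        rw [le_div_iff₀ (by linarith)] at this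
        linarith
      · push Not at hu
        have := hw u
        have := mul_nonneg ht0 hu
        linarith
    have g2 : ∀ u, w u + t * c u ≠ 0 → 0 < ∑ k, f u k := by
      intro u hu
      refine hpos u fun h0 => hu ?_
      simp [h0, h1 u h0]
    have g3 : (Finset.univ.filter fun u => w u + t * c u ≠ 0).card ≤ n := by
      have : (Finset.univ.filter fun u => w u + t * c u ≠ 0)
          ⊂ (Finset.univ.filter fun u => w u ≠ 0) := by
        rw [Finset.ssubset_iff_of_subset]
        · exact ⟨b, by simpa using hbw, by simpa using hb0⟩
        · intro u hu
          simp only [Finset.mem_filter, Finset.mem_univ, true_and] at hu ⊢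
          intro h0
          exact hu (by simp [h0, h1 u h0])
      have := Finset.card_lt_card this
      omega
    obtain ⟨w', k1, k2, k3, k4⟩ := ih (fun u => w u + t * c u) g1 g2 g3
    refine ⟨w', k1, ?_, ?_, k4⟩
    · intro k
      rw [k2 k]
      simp_rw [add_mul, Finset.sum_add_distrib, mul_assoc, ← Finset.mul_sum]
      rw [h3 k]; ring
    · refine le_trans ?_ k3
      simp_rw [add_mul, Finset.sum_add_distrib, mul_assoc, ← Finset.mul_sum]
      have := mul_nonneg ht0 h4
      linarith

lemma red {ι κ : Type*} [Fintype ι] [Fintype κ] (f : ι → κ → ℝ) (hf : ∀ u k, 0 ≤ f u k)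
    (Φ : (κ → ℝ) → ℝ) (hΦ : ∀ c m, Φ (fun k => c * m k) = c * Φ m)
    (C : (κ → ℝ) → Prop) (hC : ∀ c m, C m → C (fun k => c * m k)) (hC0 : C (fun _ => 0))
    (hfC : ∀ u, C (f u)) :
    ∃ g : κ → κ → ℝ, (∀ t k, 0 ≤ g t k) ∧ (∀ k, ∑ t, g t k = ∑ u, f u k) ∧
      (∀ t, C (g t)) ∧ ∑ u, Φ (f u) ≤ ∑ t, Φ (g t) := by
  classical
  have hΦ0 : Φ (fun _ => 0) = 0 := by
    have := hΦ 0 (fun _ => 0)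
    simpa using this
  have hz : ∀ u, ¬ 0 < ∑ k, f u k → f u = fun _ => 0 := by
    intro u hu
    have h0 : ∑ k, f u k = 0 := le_antisymm (not_lt.1 hu) (Finset.sum_nonneg fun k _ => hf u k)
    rw [Finset.sum_eq_zero_iff_of_nonneg fun k _ => hf u k] at h0
    funext k
    exact h0 k (Finset.mem_univ _)
  obtain ⟨w, hw, hsum, hobj, hcard⟩ := lp f (fun u => Φ (f u)) _
    (fun u => if 0 < ∑ k, f u k then (1 : ℝ) else 0)
    (fun u => by positivity) (fun u hu => by by_contra h; simp [h] at hu) le_rfl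
  have hsum' : ∀ k, ∑ u, w u * f u k = ∑ u, f u k := by
    intro k
    rw [hsum k]
    refine Finset.sum_congr rfl fun u _ => ?_
    by_cases h : 0 < ∑ k, f u k
    · simp [h]
    · simp [hz u h]
  have hobj' : ∑ u, Φ (f u) ≤ ∑ u, w u * Φ (f u) := by
    refine le_trans (le_of_eq ?_) hobj
    refine Finset.sum_congr rfl fun u _ => ?_
    by_cases h : 0 < ∑ k, f u k
    · simp [h]
    · simp [hz u h, hΦ0]
  have hcard' : Fintype.card {u // w u ≠ 0} ≤ Fintype.card κ := by
    rwa [Fintype.card_subtype]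
  obtain ⟨e⟩ := Function.Embedding.nonempty_of_card_le hcard'
  let g : κ → κ → ℝ := fun t =>
    if h : ∃ u : {u // w u ≠ 0}, e u = t then (fun k => w h.choose.1 * f h.choose.1 k)
      else fun _ => 0
  have hge : ∀ u, g (e u) = fun k => w u.1 * f u.1 k := by
    intro u
    have h : ∃ u' : {u // w u ≠ 0}, e u' = e u := ⟨u, rfl⟩
    have h' : h.choose = u := e.injective h.choose_spec
    simp only [g]
    rw [dif_pos h, h']
  have hgn : ∀ t, t ∉ Set.range e → g t = fun _ => 0 := by
    intro t ht
    simp only [g]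
    rw [dif_neg]
    exact fun ⟨u, hu⟩ => ht ⟨u, hu⟩
  have hsumg : ∀ Ψ : (κ → ℝ) → ℝ, (∀ c m, Ψ (fun k => c * m k) = c * Ψ m) →
      ∑ t, Ψ (g t) = ∑ u, w u * Ψ (f u) := by
    intro Ψ hΨ
    have hΨ0 : Ψ (fun _ => 0) = 0 := by
      have := hΨ 0 (fun _ => 0)
      simpa using this
    have a1 : ∑ u : {u // w u ≠ 0}, w u.1 * Ψ (f u.1) = ∑ t, Ψ (g t) := by
      refine Fintype.sum_of_injective e e.injective _ _ ?_ ?_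
      · intro t ht; rw [hgn t ht, hΨ0]
      · intro u; rw [hge u, hΨ]
    rw [← a1]
    refine Fintype.sum_of_injective Subtype.val Subtype.val_injective _ _ ?_ ?_
    · intro u hu
      have : w u = 0 := by
        by_contra hne; exact hu ⟨⟨u, hne⟩, rfl⟩
      simp [this]
    · intro u; rfl
  have hcase : ∀ t, (∃ u, g t = fun k => w u * f u k) ∨ g t = fun _ => 0 := by
    intro t
    by_cases ht : t ∈ Set.range e
    · obtain ⟨u, rfl⟩ := ht
      exact Or.inl ⟨u.1, hge u⟩
    · exact Or.inr (hgn t ht)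
  refine ⟨g, ?_, ?_, ?_, ?_⟩
  · intro t k
    rcases hcase t with ⟨u, hu⟩ | hu
    · rw [hu]; exact mul_nonneg (hw u) (hf u k)
    · rw [hu]
  · intro k
    rw [hsumg (fun m => m k) (fun c m => rfl), hsum' k]
  · intro t
    rcases hcase t with ⟨u, hu⟩ | hu
    · rw [hu]; exact hC _ _ (hfC u)
    · rw [hu]; exact hC0
  · rw [hsumg Φ hΦ]; exact hobj'

section CWs
variable {Ω 𝒳 𝒴 𝒵 𝒬 : Type*} [Fintype Ω] [Fintype 𝒳] [DecidableEq 𝒳]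
    [Fintype 𝒴] [DecidableEq 𝒴] [Fintype 𝒵] [DecidableEq 𝒵] [Fintype 𝒬] [DecidableEq 𝒬]

/-- The set whose infimum is CW. -/
def CWset (p : 𝒳 × 𝒴 × 𝒵 → ℝ) : Set ℝ :=
  {r | ∃ q : (𝒳 × 𝒴 × 𝒵) × (𝒳 × 𝒴) → ℝ,
    IsPMF q ∧ (∀ w, ∑ u, q (w, u) = p w) ∧
    condMI q (fun ω => ω.1.1) (fun ω => ω.1.2.1) (fun ω => (ω.2, ω.1.2.2)) = 0 ∧
    r = condMI q (fun ω => (ω.1.1, ω.1.2.1)) (fun ω => ω.2) (fun ω => ω.1.2.2)}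

lemma CW_eq (p : 𝒳 × 𝒴 × 𝒵 → ℝ) : CW p = sInf (CWset p) := rfl

lemma CWset_bdd (p : 𝒳 × 𝒴 × 𝒵 → ℝ) : BddBelow (CWset p) := by
  refine ⟨0, ?_⟩
  rintro r ⟨q, hq, -, -, rfl⟩
  exact condMI_nonneg hq.1 _ _ _

lemma pr_fst {α β : Type*} [Fintype α] [DecidableEq α] [Fintype β] (q : α × β → ℝ) (a : α) :
    pr q (fun ω => ω.1) a = ∑ b, q (a, b) := by
  unfold pr
  rw [Fintype.sum_prod_type]
  rw [Finset.sum_eq_single a]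
  · simp
  · intro b _ hb; simp [hb]
  · simp

lemma pr_equiv {α β : Type*} [Fintype α] [DecidableEq α] [DecidableEq β] (q : α → ℝ)
    (e : α → β) (he : Function.Injective e) (a : α) : pr q e (e a) = q a := by
  unfold pr
  rw [Finset.sum_eq_single a]
  · simp
  · intro b _ hb
    rw [if_neg]
    exact fun h => hb (he h)
  · simp

lemma CWset_nonempty (p : 𝒳 × 𝒴 × 𝒵 → ℝ) (hp : IsPMF p) : (CWset p).Nonempty := by
  refine ⟨_, fun w => pr p (fun w => (w, (w.1, w.2.1))) w, isPMF_push hp _, ?_, ?_, rfl⟩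
  · intro w
    rw [pr_sum_snd p (fun w => w) (fun w => (w.1, w.2.1)) w]
    exact pr_equiv p (fun w => w) Function.injective_id w
  · unfold condMI condH
    rw [← H_push p (fun w => (w, (w.1, w.2.1))) _ _ (fun _ => rfl),
      ← H_push p (fun w => (w, (w.1, w.2.1))) _ _ (fun _ => rfl),
      ← H_push p (fun w => (w, (w.1, w.2.1))) _ _ (fun _ => rfl),
      ← H_push p (fun w => (w, (w.1, w.2.1))) _ _ (fun _ => rfl)]
    simp only
    rw [H_eq p (fun w : 𝒳 × 𝒴 × 𝒵 => (w.1, (w.1, w.2.1), w.2.2)) (fun w => w)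
        (fun a => (a.1, a.2.1.2, a.2.2)) (fun w => (w.1, (w.1, w.2.1), w.2.2))
        (fun _ => rfl) (fun _ => rfl),
      H_eq p (fun w : 𝒳 × 𝒴 × 𝒵 => ((w.1, w.2.1), w.2.2)) (fun w => w)
        (fun a => (a.1.1, a.1.2, a.2)) (fun w => ((w.1, w.2.1), w.2.2))
        (fun _ => rfl) (fun _ => rfl),
      H_eq p (fun w : 𝒳 × 𝒴 × 𝒵 => (w.1, w.2.1, (w.1, w.2.1), w.2.2)) (fun w => w)
        (fun a => (a.1, a.2.1, a.2.2.2)) (fun w => (w.1, w.2.1, (w.1, w.2.1), w.2.2))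
        (fun _ => rfl) (fun _ => rfl),
      H_eq p (fun w : 𝒳 × 𝒴 × 𝒵 => (w.2.1, (w.1, w.2.1), w.2.2)) (fun w => w)
        (fun a => (a.2.1.1, a.1, a.2.2)) (fun w => (w.2.1, (w.1, w.2.1), w.2.2))
        (fun _ => rfl) (fun _ => rfl)]
    ring

lemma CW_le (P : Ω → ℝ) (hP : IsPMF P) (X : Ω → 𝒳) (Y : Ω → 𝒴) (Z : Ω → 𝒵) (Q : Ω → 𝒬)
    (p : 𝒳 × 𝒴 × 𝒵 → ℝ) (hp : ∀ w, pr P (fun ω => (X ω, Y ω, Z ω)) w = p w)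
    (hM : condMI P X Y (fun ω => (Q ω, Z ω)) = 0) :
    CW p ≤ condMI P (fun ω => (X ω, Y ω)) Q Z := by
  let m : 𝒵 → 𝒬 → 𝒳 × 𝒴 → ℝ := fun z u a =>
    pr P (fun ω => ((X ω, Y ω), (Q ω, Z ω))) (a, (u, z))
  have hm0 : ∀ z u a, 0 ≤ m z u a := fun z u a => pr_nonneg hP.1 _ _
  have hmG : ∀ z u, G (m z u) = 0 := by
    rw [condMI_block, Finset.sum_eq_zero_iff_of_nonneg] at hM
    · exact fun z u => hM (u, z) (Finset.mem_univ _)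
    · exact fun s _ => G_nonneg _ fun a => pr_nonneg hP.1 _ _
  have hred := fun z => red (m z) (hm0 z) F F_smul (fun k => G k = 0)
    (fun c k hk => by rw [G_smul, hk, mul_zero]) (by simp [G, et_zero]) (hmG z)
  choose g hg0 hgs hgC hgF using hred
  have hmp : ∀ x y z, ∑ u, m z u (x, y) = p (x, y, z) := by
    intro x y z
    rw [← hp]
    simp only [m]
    unfold pr
    rw [Finset.sum_comm]
    refine Finset.sum_congr rfl fun ω _ => ?_
    by_cases h : X ω = x <;> by_cases h' : Y ω = y <;> by_cases h'' : Z ω = z <;>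
      simp [h, h', h'']
  let q : (𝒳 × 𝒴 × 𝒵) × (𝒳 × 𝒴) → ℝ := fun v => g v.1.2.2 v.2 (v.1.1, v.1.2.1)
  have hqp : ∀ w, ∑ u, q (w, u) = p w := by
    rintro ⟨x, y, z⟩
    simp only [q]
    rw [hgs, hmp]
  have hp1 : ∑ w, p w = 1 := by
    simp_rw [← hp]; exact sum_pr hP _
  have hq : IsPMF q := by
    refine ⟨fun v => hg0 _ _ _, ?_⟩
    rw [Fintype.sum_prod_type]
    simp_rw [hqp]
    exact hp1
  have hprq : ∀ a t z, pr q (fun ω => ((ω.1.1, ω.1.2.1), (ω.2, ω.1.2.2))) (a, (t, z))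
      = g z t a := by
    rintro ⟨x, y⟩ t z
    have := pr_equiv q (fun ω => ((ω.1.1, ω.1.2.1), (ω.2, ω.1.2.2))) (by
      rintro ⟨⟨x, y, z⟩, t⟩ ⟨⟨x', y', z'⟩, t'⟩ h
      simp only [Prod.mk.injEq] at h ⊢
      tauto) ((x, y, z), t)
    simpa only [q] using this
  have hqM : condMI q (fun ω => ω.1.1) (fun ω => ω.1.2.1) (fun ω => (ω.2, ω.1.2.2)) = 0 := by
    rw [condMI_block]
    refine Finset.sum_eq_zero fun s _ => ?_
    obtain ⟨t, z⟩ := s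
    simp_rw [hprq]
    exact hgC z t
  refine le_trans (csInf_le (CWset_bdd p) ⟨q, hq, hqp, hqM, rfl⟩) ?_
  have hq1 : ∀ w, pr q (fun ω => ω.1) w = p w := fun w => by rw [pr_fst, hqp]
  have c1 : condH q (fun ω => (ω.1.1, ω.1.2.1)) (fun ω => ω.1.2.2)
      = condH P (fun ω => (X ω, Y ω)) Z := by
    unfold condH
    rw [H_push q (fun ω => ω.1) (fun w => ((w.1, w.2.1), w.2.2)) p hq1,
      H_push q (fun ω => ω.1) (fun w => w.2.2) p hq1,
      ← H_push P _ (fun w => ((w.1, w.2.1), w.2.2)) p hp,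
      ← H_push P _ (fun w => w.2.2) p hp]
  have c2 : condH P (fun ω => (X ω, Y ω)) (fun ω => (Q ω, Z ω))
      ≤ condH q (fun ω => (ω.1.1, ω.1.2.1)) (fun ω => (ω.2, ω.1.2.2)) := by
    rw [condH_block, condH_block, Fintype.sum_prod_type, Fintype.sum_prod_type,
      Finset.sum_comm, Finset.sum_comm (s := (Finset.univ : Finset (𝒳 × 𝒴)))]
    refine Finset.sum_le_sum fun z _ => ?_
    simp_rw [hprq]
    exact hgF z
  unfold condMI
  rw [c1]
  linarith

end CWs

lemma lower {Ω 𝒬 𝒳₁ 𝒴₁ 𝒵₁ 𝒳₂ 𝒴₂ 𝒵₂ : Type*} [Fintype Ω] [Fintype 𝒬] [DecidableEq 𝒬]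
    [Fintype 𝒳₁] [DecidableEq 𝒳₁] [Fintype 𝒴₁] [DecidableEq 𝒴₁]
    [Fintype 𝒵₁] [DecidableEq 𝒵₁] [Fintype 𝒳₂] [DecidableEq 𝒳₂]
    [Fintype 𝒴₂] [DecidableEq 𝒴₂] [Fintype 𝒵₂] [DecidableEq 𝒵₂]
    (P : Ω → ℝ) (hP : IsPMF P)
    (p₁ : 𝒳₁ × 𝒴₁ × 𝒵₁ → ℝ) (p₂ : 𝒳₂ × 𝒴₂ × 𝒵₂ → ℝ) (hp₁ : IsPMF p₁) (hp₂ : IsPMF p₂)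
    (X₁ : Ω → 𝒳₁) (X₂ : Ω → 𝒳₂) (Y₁ : Ω → 𝒴₁) (Y₂ : Ω → 𝒴₂) (Z₁ : Ω → 𝒵₁) (Z₂ : Ω → 𝒵₂)
    (Q : Ω → 𝒬)
    (hlaw : ∀ w : (𝒳₁ × 𝒳₂) × (𝒴₁ × 𝒴₂) × (𝒵₁ × 𝒵₂),
      pr P (fun ω => ((X₁ ω, X₂ ω), (Y₁ ω, Y₂ ω), (Z₁ ω, Z₂ ω))) w =
        p₁ (w.1.1, w.2.1.1, w.2.2.1) * p₂ (w.1.2, w.2.1.2, w.2.2.2))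
    (hI : condMI P (fun ω => (X₁ ω, X₂ ω)) (fun ω => (Y₁ ω, Y₂ ω))
      (fun ω => (Q ω, (Z₁ ω, Z₂ ω))) = 0) :
    CW p₁ + CW p₂ ≤ condMI P (fun ω => ((X₁ ω, X₂ ω), (Y₁ ω, Y₂ ω))) Q
      (fun ω => (Z₁ ω, Z₂ ω)) := by
  have hW : ∀ a b, pr P (fun ω => ((X₁ ω, Y₁ ω, Z₁ ω), (X₂ ω, Y₂ ω, Z₂ ω))) (a, b)
      = p₁ a * p₂ b := by
    rintro ⟨x₁, y₁, z₁⟩ ⟨x₂, y₂, z₂⟩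
    rw [← hlaw ((x₁, x₂), (y₁, y₂), (z₁, z₂))]
    exact (pr_inj P (fun ω => ((X₁ ω, Y₁ ω, Z₁ ω), (X₂ ω, Y₂ ω, Z₂ ω)))
          (fun v => ((v.1.1, v.2.1), (v.1.2.1, v.2.2.1), (v.1.2.2, v.2.2.2)))
          (by
            rintro ⟨⟨x, y, z⟩, ⟨x', y', z'⟩⟩ ⟨⟨a, b, c⟩, ⟨a', b', c'⟩⟩ h
            simp only [Prod.mk.injEq] at h ⊢
            tauto) ((x₁, y₁, z₁), (x₂, y₂, z₂))).symm
  have hl₁ : ∀ a, pr P (fun ω => (X₁ ω, Y₁ ω, Z₁ ω)) a = p₁ a := by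
    intro a
    rw [← pr_sum_snd P _ (fun ω => (X₂ ω, Y₂ ω, Z₂ ω))]
    simp_rw [hW]
    rw [← Finset.mul_sum, hp₂.2, mul_one]
  have hl₂ : ∀ a, pr P (fun ω => (X₂ ω, Y₂ ω, Z₂ ω)) a = p₂ a := by
    intro a
    rw [← pr_sum_fst P (fun ω => (X₁ ω, Y₁ ω, Z₁ ω))]
    simp_rw [hW]
    rw [← Finset.sum_mul, hp₁.2, one_mul]
  have hM₁ : condMI P X₁ Y₁ (fun ω => (Q ω, (Z₁ ω, Z₂ ω))) = 0 := by
    refine le_antisymm ?_ (condMI_nonneg hP.1 _ _ _)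
    refine (condMI_dp hP.1 (fun ω => (X₁ ω, X₂ ω)) Y₁ _ (fun a => a.1)).trans ?_
    rw [condMI_symm, ← hI, condMI_symm P _ (fun ω => (Y₁ ω, Y₂ ω))]
    exact condMI_dp hP.1 (fun ω => (Y₁ ω, Y₂ ω)) _ _ (fun a => a.1)
  have hM₂ : condMI P X₂ Y₂ (fun ω => (Q ω, (Z₁ ω, Z₂ ω))) = 0 := by
    refine le_antisymm ?_ (condMI_nonneg hP.1 _ _ _)
    refine (condMI_dp hP.1 (fun ω => (X₁ ω, X₂ ω)) Y₂ _ (fun a => a.2)).trans ?_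
    rw [condMI_symm, ← hI, condMI_symm P _ (fun ω => (Y₁ ω, Y₂ ω))]
    exact condMI_dp hP.1 (fun ω => (Y₁ ω, Y₂ ω)) _ _ (fun a => a.2)
  have hle₁ := CW_le P hP X₁ Y₁ Z₁ (fun ω => (Q ω, Z₂ ω)) p₁ hl₁ (by
    rw [← hM₁]
    exact condMI_congr P _ _ _ _ _ (fun a => a) (fun a => a)
      (fun s => (s.1.1, (s.2, s.1.2))) (fun s => ((s.1, s.2.2), s.2.1))
      (fun _ => rfl) (fun _ => rfl) (fun _ => rfl) (fun _ => rfl))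
  have hle₂ := CW_le P hP X₂ Y₂ Z₂ (fun ω => (Q ω, Z₁ ω)) p₂ hl₂ (by
    rw [← hM₂]
    exact condMI_congr P _ _ _ _ _ (fun a => a) (fun a => a)
      (fun s => (s.1.1, (s.1.2, s.2))) (fun s => ((s.1, s.2.1), s.2.2))
      (fun _ => rfl) (fun _ => rfl) (fun _ => rfl) (fun _ => rfl))
  have hsub := condMI_nonneg hP.1 (fun ω => (X₁ ω, Y₁ ω)) (fun ω => (X₂ ω, Y₂ ω))
    (fun ω => (Q ω, (Z₁ ω, Z₂ ω)))
  have eZ := H_prod P _ _ p₁ p₂ hp₁ hp₂ hW (fun v => v.2.2) (fun v => v.2.2)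
  have eA := H_prod P _ _ p₁ p₂ hp₁ hp₂ hW (fun v => ((v.1, v.2.1), v.2.2))
    (fun v => ((v.1, v.2.1), v.2.2))
  rw [← H_push P _ _ p₁ hl₁, ← H_push P _ _ p₂ hl₂] at eZ eA
  rw [H_eq P _ (fun ω => (((X₁ ω, X₂ ω), (Y₁ ω, Y₂ ω)), (Z₁ ω, Z₂ ω)))
    (fun v => (((v.1.1.1, v.2.1.1), (v.1.1.2, v.2.1.2)), (v.1.2, v.2.2)))
    (fun v => (((v.1.1.1, v.1.2.1), v.2.1), ((v.1.1.2, v.1.2.2), v.2.2)))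
    (fun _ => rfl) (fun _ => rfl)] at eA
  unfold condMI condH at hle₁ hle₂ hsub ⊢
  rw [H_eq P (fun ω => ((Q ω, Z₂ ω), Z₁ ω)) (fun ω => (Q ω, (Z₁ ω, Z₂ ω)))
      (fun s => (s.1.1, (s.2, s.1.2))) (fun s => ((s.1, s.2.2), s.2.1))
      (fun _ => rfl) (fun _ => rfl),
    H_eq P (fun ω => ((X₁ ω, Y₁ ω), (Q ω, Z₂ ω), Z₁ ω))
      (fun ω => ((X₁ ω, Y₁ ω), Q ω, (Z₁ ω, Z₂ ω)))
      (fun s => (s.1, s.2.1.1, (s.2.2, s.2.1.2))) (fun s => (s.1, (s.2.1, s.2.2.2), s.2.2.1))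
      (fun _ => rfl) (fun _ => rfl)] at hle₁
  rw [H_eq P (fun ω => ((Q ω, Z₁ ω), Z₂ ω)) (fun ω => (Q ω, (Z₁ ω, Z₂ ω)))
      (fun s => (s.1.1, (s.1.2, s.2))) (fun s => ((s.1, s.2.1), s.2.2))
      (fun _ => rfl) (fun _ => rfl),
    H_eq P (fun ω => ((X₂ ω, Y₂ ω), (Q ω, Z₁ ω), Z₂ ω))
      (fun ω => ((X₂ ω, Y₂ ω), Q ω, (Z₁ ω, Z₂ ω)))
      (fun s => (s.1, s.2.1.1, (s.2.1.2, s.2.2))) (fun s => (s.1, (s.2.1, s.2.2.1), s.2.2.2))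
      (fun _ => rfl) (fun _ => rfl)] at hle₂
  rw [H_eq P (fun ω => ((X₁ ω, Y₁ ω), (X₂ ω, Y₂ ω), Q ω, (Z₁ ω, Z₂ ω)))
      (fun ω => (((X₁ ω, X₂ ω), (Y₁ ω, Y₂ ω)), Q ω, (Z₁ ω, Z₂ ω)))
      (fun s => (((s.1.1, s.2.1.1), (s.1.2, s.2.1.2)), s.2.2))
      (fun s => ((s.1.1.1, s.1.2.1), (s.1.1.2, s.1.2.2), s.2))
      (fun _ => rfl) (fun _ => rfl)] at hsub
  linarith

end CWAux

open CWAux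
/-- additivity of conditional Wyner common information on independent
triples: for the product distribution of (X1,Y1,Z1) and (X2,Y2,Z2),
C_W(X1X2;Y1Y2|Z1Z2) = C_W(X1;Y1|Z1) + C_W(X2;Y2|Z2). -/
theorem CW_additive {𝒳₁ 𝒴₁ 𝒵₁ 𝒳₂ 𝒴₂ 𝒵₂ : Type*}
    [Fintype 𝒳₁] [DecidableEq 𝒳₁] [Fintype 𝒴₁] [DecidableEq 𝒴₁]
    [Fintype 𝒵₁] [DecidableEq 𝒵₁] [Fintype 𝒳₂] [DecidableEq 𝒳₂]
    [Fintype 𝒴₂] [DecidableEq 𝒴₂] [Fintype 𝒵₂] [DecidableEq 𝒵₂]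
    (p₁ : 𝒳₁ × 𝒴₁ × 𝒵₁ → ℝ) (p₂ : 𝒳₂ × 𝒴₂ × 𝒵₂ → ℝ)
    (hp₁ : IsPMF p₁) (hp₂ : IsPMF p₂) :
    CW (fun w : (𝒳₁ × 𝒳₂) × (𝒴₁ × 𝒴₂) × (𝒵₁ × 𝒵₂) =>
        p₁ (w.1.1, w.2.1.1, w.2.2.1) * p₂ (w.1.2, w.2.1.2, w.2.2.2)) =
      CW p₁ + CW p₂ := by
  have hS : IsPMF (fun w : (𝒳₁ × 𝒳₂) × (𝒴₁ × 𝒴₂) × (𝒵₁ × 𝒵₂) =>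
      p₁ (w.1.1, w.2.1.1, w.2.2.1) * p₂ (w.1.2, w.2.1.2, w.2.2.2)) := by
    refine ⟨fun w => mul_nonneg (hp₁.1 _) (hp₂.1 _), ?_⟩
    have h : ∑ v : (𝒳₁ × 𝒴₁ × 𝒵₁) × (𝒳₂ × 𝒴₂ × 𝒵₂), p₁ v.1 * p₂ v.2 = 1 := by
      rw [Fintype.sum_prod_type, ← Finset.sum_mul_sum, hp₁.2, hp₂.2, one_mul]
    rw [← h]
    exact Fintype.sum_equiv
      ⟨fun w => ((w.1.1, w.2.1.1, w.2.2.1), (w.1.2, w.2.1.2, w.2.2.2)),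
        fun v => ((v.1.1, v.2.1), (v.1.2.1, v.2.2.1), (v.1.2.2, v.2.2.2)),
        fun _ => rfl, fun _ => rfl⟩ _ _ (fun _ => rfl)
  apply le_antisymm
  · -- upper bound
    have main : ∀ r₁ ∈ CWset p₁, ∀ r₂ ∈ CWset p₂,
        CW (fun w : (𝒳₁ × 𝒳₂) × (𝒴₁ × 𝒴₂) × (𝒵₁ × 𝒵₂) =>
        p₁ (w.1.1, w.2.1.1, w.2.2.1) * p₂ (w.1.2, w.2.1.2, w.2.2.2)) ≤ r₁ + r₂ := by
      rintro r₁ ⟨q₁, hq₁, hm₁, hI₁, rfl⟩ r₂ ⟨q₂, hq₂, hm₂, hI₂, rfl⟩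
      let P : ((𝒳₁ × 𝒴₁ × 𝒵₁) × (𝒳₁ × 𝒴₁)) × ((𝒳₂ × 𝒴₂ × 𝒵₂) × (𝒳₂ × 𝒴₂)) → ℝ :=
        fun v => q₁ v.1 * q₂ v.2
      have hP : IsPMF P := isPMF_prod hq₁ hq₂
      have hlaw : ∀ w, pr P (fun ω => ((ω.1.1.1, ω.2.1.1), (ω.1.1.2.1, ω.2.1.2.1),
          (ω.1.1.2.2, ω.2.1.2.2))) w =
          p₁ (w.1.1, w.2.1.1, w.2.2.1) * p₂ (w.1.2, w.2.1.2, w.2.2.2) := by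
        rintro ⟨⟨x₁, x₂⟩, ⟨y₁, y₂⟩, ⟨z₁, z₂⟩⟩
        have h := pr_prod q₁ q₂ (fun v => v.1) (fun v => v.1) (x₁, y₁, z₁) (x₂, y₂, z₂)
        rw [pr_fst, pr_fst, hm₁, hm₂] at h
        rw [← h]
        exact pr_inj P (fun ω => (ω.1.1, ω.2.1))
          (fun v => ((v.1.1, v.2.1), (v.1.2.1, v.2.2.1), (v.1.2.2, v.2.2.2)))
          (by
            rintro ⟨⟨x, y, z⟩, ⟨x', y', z'⟩⟩ ⟨⟨a, b, c⟩, ⟨a', b', c'⟩⟩ h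
            simp only [Prod.mk.injEq] at h ⊢
            tauto) ((x₁, y₁, z₁), (x₂, y₂, z₂))
      have hle := CW_le P hP (fun ω => (ω.1.1.1, ω.2.1.1)) (fun ω => (ω.1.1.2.1, ω.2.1.2.1))
        (fun ω => (ω.1.1.2.2, ω.2.1.2.2)) (fun ω => (ω.1.2, ω.2.2)) _ hlaw
      refine (hle ?_).trans (le_of_eq ?_)
      · have e := condMI_prod hq₁ hq₂ (fun v => v.1.1) (fun v => v.1.1) (fun v => v.1.2.1)
          (fun v => v.1.2.1) (fun v => (v.2, v.1.2.2)) (fun v => (v.2, v.1.2.2))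
        rw [hI₁, hI₂, add_zero] at e
        rw [← e]
        exact condMI_congr P _ _ _ _ _ (fun a => a) (fun a => a)
          (fun s => ((s.1.1, s.2.1), (s.1.2, s.2.2))) (fun s => ((s.1.1, s.2.1), (s.1.2, s.2.2)))
          (fun _ => rfl) (fun _ => rfl) (fun _ => rfl) (fun _ => rfl)
      · rw [← condMI_prod hq₁ hq₂]
        exact condMI_congr P _ _ _ _ _ (fun s => ((s.1.1, s.2.1), (s.1.2, s.2.2)))
          (fun s => ((s.1.1, s.2.1), (s.1.2, s.2.2))) (fun a => a) (fun a => a)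
          (fun _ => rfl) (fun _ => rfl) (fun _ => rfl) (fun _ => rfl)
    rw [CW_eq p₁, CW_eq p₂]
    have h2 : ∀ r₁ ∈ CWset p₁, CW (fun w : (𝒳₁ × 𝒳₂) × (𝒴₁ × 𝒴₂) × (𝒵₁ × 𝒵₂) =>
        p₁ (w.1.1, w.2.1.1, w.2.2.1) * p₂ (w.1.2, w.2.1.2, w.2.2.2)) - r₁ ≤ sInf (CWset p₂) :=
      fun r₁ hr₁ => le_csInf (CWset_nonempty p₂ hp₂) fun r₂ hr₂ => by
        have := main r₁ hr₁ r₂ hr₂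
        linarith
    have h3 : CW (fun w : (𝒳₁ × 𝒳₂) × (𝒴₁ × 𝒴₂) × (𝒵₁ × 𝒵₂) =>
        p₁ (w.1.1, w.2.1.1, w.2.2.1) * p₂ (w.1.2, w.2.1.2, w.2.2.2)) - sInf (CWset p₂)
        ≤ sInf (CWset p₁) :=
      le_csInf (CWset_nonempty p₁ hp₁) fun r₁ hr₁ => by
        have := h2 r₁ hr₁
        linarith
    linarith
  · -- lower bound
    rw [CW_eq (fun w : (𝒳₁ × 𝒳₂) × (𝒴₁ × 𝒴₂) × (𝒵₁ × 𝒵₂) => _)]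
    refine le_csInf (CWset_nonempty _ hS) ?_
    rintro r ⟨q, hq, hm, hI, rfl⟩
    have hq1 : ∀ w, pr q (fun ω => ω.1) w =
        p₁ (w.1.1, w.2.1.1, w.2.2.1) * p₂ (w.1.2, w.2.1.2, w.2.2.2) := fun w => by
      rw [pr_fst, hm]
    exact lower q hq p₁ p₂ hp₁ hp₂ (fun ω => ω.1.1.1) (fun ω => ω.1.1.2) (fun ω => ω.1.2.1.1)
      (fun ω => ω.1.2.1.2) (fun ω => ω.1.2.2.1) (fun ω => ω.1.2.2.2) (fun ω => ω.2)
      (fun w => hq1 w) hI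
end

section
/- If p_{XY} is indecomposable (its characteristic bipartite graph has a single connected component), then any random variable Q with H(Q|X)=H(Q|Y)=0 is almost surely constant, and hence C_GK(X;Y)=0. -/
open Finset

theorem pr_pos_aux {Ω A : Type*} [Fintype Ω] [DecidableEq A] {p : Ω → ℝ}
    (hp : ∀ ω, 0 ≤ p ω) (X : Ω → A) (ω : Ω) (h : 0 < p ω) : 0 < pr p X (X ω) := by
  have : p ω ≤ pr p X (X ω) := by
    unfold pr
    have := Finset.single_le_sum (f := fun w => if X w = X ω then p w else 0)
      (fun w _ => by split_ifs; exacts [hp w, le_rfl]) (Finset.mem_univ ω)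
    simpa using this
  linarith

theorem pr_exists_aux {Ω A : Type*} [Fintype Ω] [DecidableEq A] {p : Ω → ℝ}
    (X : Ω → A) (a : A) (h : 0 < pr p X a) : ∃ ω, 0 < p ω ∧ X ω = a := by
  unfold pr at h
  obtain ⟨w, -, hw⟩ := Finset.exists_lt_of_sum_lt (s := Finset.univ) (f := fun _ : Ω => (0:ℝ))
    (by simpa using h)
  by_cases hx : X w = a
  · exact ⟨w, by simpa [hx] using hw, hx⟩
  · simp [hx] at hw

theorem H_aux {Ω A : Type*} [Fintype Ω] [Fintype A] [DecidableEq A] (p : Ω → ℝ)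
    (X : Ω → A) : H p X = -∑ ω, p ω * Real.logb 2 (pr p X (X ω)) := by
  have : ∀ x, pr p X x * Real.logb 2 (pr p X x)
      = ∑ ω, if X ω = x then p ω * Real.logb 2 (pr p X x) else 0 := by
    intro x
    conv_lhs => enter [1]; unfold pr
    rw [Finset.sum_mul]
    simp only [ite_mul, zero_mul]
  unfold H
  simp only [this]
  rw [Finset.sum_comm]
  simp

theorem det_aux {Ω A B : Type*} [Fintype Ω] [Fintype A] [DecidableEq A] [Fintype B]
    [DecidableEq B] {p : Ω → ℝ} (hp : ∀ ω, 0 ≤ p ω) (Q : Ω → A) (X : Ω → B)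
    (h : condH p Q X = 0) (w v : Ω) (hw : 0 < p w) (hv : 0 < p v) (hx : X v = X w) :
    Q v = Q w := by
  have hle : ∀ ω, pr p (fun ω => (Q ω, X ω)) (Q ω, X ω) ≤ pr p X (X ω) := by
    intro ω
    unfold pr
    refine Finset.sum_le_sum fun u _ => ?_
    have := hp u
    by_cases h1 : X u = X ω <;> by_cases h2 : Q u = Q ω <;> simp [h1, h2, this]
  have hpos : ∀ ω, 0 < p ω → 0 < pr p (fun ω => (Q ω, X ω)) (Q ω, X ω) := fun ω h =>
    pr_pos_aux hp (fun ω => (Q ω, X ω)) ω h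
  rw [condH, H_aux, H_aux] at h
  have hs : ∑ ω, p ω * (Real.logb 2 (pr p X (X ω))
      - Real.logb 2 (pr p (fun ω => (Q ω, X ω)) (Q ω, X ω))) = 0 := by
    simp only [mul_sub, Finset.sum_sub_distrib]
    linarith
  rw [Finset.sum_eq_zero_iff_of_nonneg] at hs
  · have h0 := hs w (Finset.mem_univ _)
    have h1 : pr p X (X w) = pr p (fun ω => (Q ω, X ω)) (Q w, X w) := by
      have h2 := (mul_eq_zero.1 h0).resolve_left hw.ne'
      exact Real.logb_injOn_pos (by norm_num : (1:ℝ) < 2) (pr_pos_aux hp X w hw) (hpos w hw)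
        (by linarith)
    by_contra hq
    refine absurd h1 (ne_of_gt ?_)
    unfold pr
    refine Finset.sum_lt_sum (fun u _ => ?_) ⟨v, Finset.mem_univ _, by simp [hx, hq, hv]⟩
    have := hp u
    by_cases h1 : X u = X w <;> by_cases h2 : Q u = Q w <;> simp [h1, h2, this]
  · intro ω _
    rcases (hp ω).eq_or_lt with h0 | h0
    · simp [← h0]
    · exact mul_nonneg h0.le (sub_nonneg.2
        (Real.logb_le_logb_of_le (by norm_num) (hpos ω h0) (hle ω)))

/-- if p_XY is indecomposable (its characteristic bipartite graph,
restricted to values of positive marginal probability, is connected, where x and x'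
are adjacent-via-y iff both (x,y) and (x',y) have positive probability), then every
common function Q of X and Y is almost surely constant, and hence H(Q)=0,
so C_GK(X;Y)=0. -/
theorem GK_zero_of_indecomposable {Ω 𝒳 𝒴 𝒬 : Type*} [Fintype Ω]
    [Fintype 𝒳] [DecidableEq 𝒳] [Fintype 𝒴] [DecidableEq 𝒴]
    [Fintype 𝒬] [DecidableEq 𝒬]
    (p : Ω → ℝ) (X : Ω → 𝒳) (Y : Ω → 𝒴)
    (hp : IsPMF p)
    (hind : ∀ x x' : 𝒳, 0 < pr p X x → 0 < pr p X x' →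
      Relation.ReflTransGen
        (fun a a' : 𝒳 => ∃ y : 𝒴,
          0 < pr p (fun ω => (X ω, Y ω)) (a, y) ∧
          0 < pr p (fun ω => (X ω, Y ω)) (a', y)) x x')
    (Q : Ω → 𝒬) (h1 : condH p Q X = 0) (h2 : condH p Q Y = 0) :
    (∃ q₀ : 𝒬, pr p Q q₀ = 1) ∧ H p Q = 0 := by
  obtain ⟨hp0, hp1⟩ := hp
  obtain ⟨w, hw⟩ : ∃ w, 0 < p w := by
    by_contra! hc
    have : ∑ ω, p ω ≤ 0 := Finset.sum_nonpos fun i _ => hc i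
    linarith
  have key : ∀ x, Relation.ReflTransGen
        (fun a a' : 𝒳 => ∃ y : 𝒴,
          0 < pr p (fun ω => (X ω, Y ω)) (a, y) ∧
          0 < pr p (fun ω => (X ω, Y ω)) (a', y)) (X w) x →
      ∀ v, 0 < p v → X v = x → Q v = Q w := by
    intro x hr
    induction hr with
    | refl => exact fun v hv hx => det_aux hp0 Q X h1 w v hw hv hx
    | tail _ hs ih =>
      intro v hv hx
      obtain ⟨y, ha, hb⟩ := hs
      obtain ⟨u1, hu1, e1⟩ := pr_exists_aux _ _ ha
      obtain ⟨u2, hu2, e2⟩ := pr_exists_aux _ _ hb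
      simp only [Prod.mk.injEq] at e1 e2
      rw [det_aux hp0 Q X h1 u2 v hu2 hv (hx.trans e2.1.symm),
        det_aux hp0 Q Y h2 u1 u2 hu1 hu2 (e2.2.trans e1.2.symm)]
      exact ih u1 hu1 e1.1
  have hQ : ∀ v, 0 < p v → Q v = Q w := fun v hv =>
    key _ (hind _ _ (pr_pos_aux hp0 X w hw) (pr_pos_aux hp0 X v hv)) v hv rfl
  have hone : pr p Q (Q w) = 1 := by
    rw [← hp1]
    unfold pr
    refine Finset.sum_congr rfl fun v _ => ?_
    rcases (hp0 v).eq_or_lt with h0 | h0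
    · simp [← h0]
    · simp [hQ v h0]
  refine ⟨⟨Q w, hone⟩, ?_⟩
  rw [H_aux, neg_eq_zero]
  refine Finset.sum_eq_zero fun v _ => ?_
  rcases (hp0 v).eq_or_lt with h0 | h0
  · simp [← h0]
  · simp [hQ v h0, hone]
end
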